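/- arXiv:2304.04531 — 2 statements merged into one kernel-verified Lean document; each statement's English description precedes it below -/
import Mathlib

section
/- Let n be an even positive integer and let G be a Δ-regular bipartite simple graph on 2n vertices with bipartition into the parts {1,…,n} and {n+1,…,2n}, where Δ is even. Then the coefficient of the monomial (X_1 X_2 ⋯ X_{2n})^{Δ/2} in the graph polynomial P_G is nonzero. -/
open MvPolynomial

/-- The graph polynomial `∏_{i<j, ij ∈ E(G)} (X_i - X_j)` of a finite simple graph,
with respect to a linear order `ord` on the vertices. -/
noncomputable def graphPoly {V : Type*} [Fintype V] (G : SimpleGraph V) (ord : LinearOrder V) :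
    MvPolynomial V ℤ := by
  classical
  exact ∏ p ∈ Finset.univ.filter (fun p : V × V => ord.lt p.1 p.2 ∧ G.Adj p.1 p.2),
    (X p.1 - X p.2)

/-- The largest exponent occurring in a monomial. -/
noncomputable def maxExp {V : Type*} [Fintype V] (m : V →₀ ℕ) : ℕ :=
  Finset.univ.sup ⇑m

/-- The Alon–Tarsi number of a finite simple graph (with respect to a linear order on its
vertices): one plus the minimum, over all monomials occurring with nonzero coefficient in the
graph polynomial, of the largest exponent occurring in that monomial. -/
noncomputable def ATNumber {V : Type*} [Fintype V] (G : SimpleGraph V) (ord : LinearOrder V) : ℕ :=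
  1 + sInf { k : ℕ | ∃ m ∈ (graphPoly G ord).support, maxExp m = k }

/-- A biregular relation of positive degree contains a perfect matching. -/
theorem exists_injective_mem_of_biregular {V : Type*} [Fintype V] [DecidableEq V] {d : ℕ}
    (hd : 0 < d) (t : V → Finset V) (ht : ∀ v, (t v).card = d)
    (ht' : ∀ v, (Finset.univ.filter fun u => v ∈ t u).card = d) :
    ∃ f : V → V, Function.Injective f ∧ ∀ v, f v ∈ t v := by
  rw [← Finset.all_card_le_biUnion_card_iff_exists_injective]
  intro A
  refine Nat.le_of_mul_le_mul_right
    (Finset.card_mul_le_card_mul (fun a b => b ∈ t a) (m := d) (n := d) ?_ ?_) hd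
  · intro a ha
    rw [← ht a]
    refine Finset.card_le_card fun b hb => ?_
    rw [Finset.mem_bipartiteAbove]
    exact ⟨Finset.mem_biUnion.2 ⟨a, ha, hb⟩, hb⟩
  · intro b _
    rw [← ht' b]
    refine Finset.card_le_card fun a ha => ?_
    simpa using (Finset.mem_bipartiteBelow _).1 ha |>.2

/-- A biregular relation of degree `d` contains a biregular relation of every degree `k ≤ d`. -/
theorem exists_biregular_subset {V : Type*} [Fintype V] [DecidableEq V] {k d : ℕ}
    (t : V → Finset V) (ht : ∀ v, (t v).card = d)
    (ht' : ∀ v, (Finset.univ.filter fun u => v ∈ t u).card = d) (hkd : k ≤ d) :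
    ∃ s : V → Finset V, (∀ v, s v ⊆ t v) ∧ (∀ v, (s v).card = k) ∧
      ∀ v, (Finset.univ.filter fun u => v ∈ s u).card = k := by
  induction hkd using Nat.decreasingInduction with
  | self => exact ⟨t, fun v => Finset.Subset.refl _, ht, ht'⟩
  | of_succ k _ ih =>
    obtain ⟨s, hst, hs, hs'⟩ := ih
    obtain ⟨f, hf, hfs⟩ := exists_injective_mem_of_biregular k.succ_pos s hs hs'
    refine ⟨fun v => (s v).erase (f v), fun v => (Finset.erase_subset _ _).trans (hst v),
      fun v => by rw [Finset.card_erase_of_mem (hfs v), hs v, Nat.add_sub_cancel], fun v => ?_⟩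
    obtain ⟨w, rfl⟩ := Finite.surjective_of_injective hf v
    have : (Finset.univ.filter fun u => f w ∈ (s u).erase (f u)) =
        (Finset.univ.filter fun u => f w ∈ s u).erase w := by
      ext u
      simp [hf.eq_iff, eq_comm]
    rw [this, Finset.card_erase_of_mem (by simpa using hfs w), hs' (f w), Nat.add_sub_cancel]

/-- If every pair in `E` has its second, but not its first, component in `B`, then all
contributions to a given coefficient of `∏ (X i - X j)` over `(i, j) ∈ E` have the same sign, so the
coefficient is nonzero as soon as there is a contribution. -/
theorem coeff_prod_X_sub_X_ne_zero {V : Type*} [Fintype V] [DecidableEq V] (E : Finset (V × V))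
    (B : V → Prop) (m : V →₀ ℕ) (hB : ∀ p ∈ E, ¬ B p.1 ∧ B p.2)
    (hm : ∃ S ⊆ E, (∑ p ∈ S, Finsupp.single p.1 1 + ∑ p ∈ E \ S, Finsupp.single p.2 1) = m) :
    coeff m (∏ p ∈ E, (X p.1 - X p.2 : MvPolynomial V ℤ)) ≠ 0 := by
  classical
  let mon (S : Finset (V × V)) : V →₀ ℕ :=
    ∑ p ∈ S, Finsupp.single p.1 1 + ∑ p ∈ E \ S, Finsupp.single p.2 1
  let c : ℕ := ∑ v with B v, m v
  have hcard (S) (hS : S ⊆ E) (h : mon S = m) : (E \ S).card = c := by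
    simp only [c, ← h, mon, Finsupp.add_apply, Finsupp.finsetSum_apply, Finset.sum_add_distrib]
    rw [Finset.sum_comm, Finset.sum_comm (t := E \ S), Finset.sum_eq_zero, zero_add,
      Finset.card_eq_sum_ones]
    · refine Finset.sum_congr rfl fun p hp => ?_
      simp [Finsupp.single_apply, (hB p (Finset.mem_sdiff.1 hp).1).2]
    · intro p hp
      simp [Finsupp.single_apply, (hB p (hS hp)).1]
  have hcoeff : coeff m (∏ p ∈ E, (X p.1 - X p.2 : MvPolynomial V ℤ)) =
      (-1) ^ c * (E.powerset.filter fun S => mon S = m).card := by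
    simp only [sub_eq_add_neg]
    rw [Finset.prod_add, coeff_sum, Finset.card_filter, Nat.cast_sum, Finset.mul_sum]
    refine Finset.sum_congr rfl fun S hS => ?_
    have hterm : (∏ p ∈ S, (X p.1 : MvPolynomial V ℤ)) * ∏ p ∈ E \ S, -X p.2 =
        C ((-1) ^ (E \ S).card) * monomial (mon S) 1 := by
      have hmon : (monomial (mon S) 1 : MvPolynomial V ℤ) =
          (∏ p ∈ S, X p.1) * ∏ p ∈ E \ S, X p.2 := by
        simp only [mon, X, ← monomial_sum_one, monomial_mul, mul_one]
      rw [Finset.prod_neg, hmon, map_pow, map_neg, map_one]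
      ring
    rw [hterm, coeff_C_mul, coeff_monomial]
    split_ifs with h
    · simp [hcard S (Finset.mem_powerset.1 hS) h]
    · simp
  obtain ⟨S, hS, hSm⟩ := hm
  rw [hcoeff]
  refine mul_ne_zero (by simp) (Nat.cast_ne_zero.2 (Finset.card_ne_zero_of_mem (a := S) ?_))
  exact Finset.mem_filter.2 ⟨Finset.mem_powerset.2 hS, hSm⟩

/-- for an even positive n and a Δ-regular bipartite simple graph G on 2n vertices
with parts {0,…,n-1} and {n,…,2n-1} and Δ even, the coefficient of (X_1⋯X_{2n})^{Δ/2} in the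
graph polynomial of G is nonzero. -/
theorem statement_6 (n : ℕ) (hn : 0 < n) (hev : Even n) (Δ : ℕ) (hΔ : Even Δ)
    (G : SimpleGraph (Fin (n + n))) [DecidableRel G.Adj]
    (hreg : G.IsRegularOfDegree Δ)
    (hbip : ∀ i j : Fin (n + n), G.Adj i j → (((i : ℕ) < n) ≠ ((j : ℕ) < n))) :
    MvPolynomial.coeff (Finsupp.equivFunOnFinite.symm fun _ : Fin (n + n) => Δ / 2)
      (graphPoly G inferInstance) ≠ 0 := by
  obtain ⟨k, hk⟩ := hΔ
  have hk2 : Δ / 2 = k := by omega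
  set m : Fin (n + n) →₀ ℕ := Finsupp.equivFunOnFinite.symm fun _ => Δ / 2 with hm
  classical
  have hE (p : Fin (n + n) × Fin (n + n)) (hp : p.1 < p.2 ∧ G.Adj p.1 p.2) :
      (p.1 : ℕ) < n ∧ ¬ (p.2 : ℕ) < n := by
    have h := hbip _ _ hp.2
    have h1 : (p.1 : ℕ) < p.2 := hp.1
    by_cases h2 : (p.1 : ℕ) < n <;> by_cases h3 : (p.2 : ℕ) < n <;> simp_all
    omega
  unfold graphPoly
  refine coeff_prod_X_sub_X_ne_zero _ (fun v : Fin (n + n) => ¬ (v : ℕ) < n) m ?_ ?_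
  · intro p hp
    have := hE p (by simpa using hp)
    simpa using this
  have hlt (v w : Fin (n + n)) (h : G.Adj v w) (hv : (v : ℕ) < n) : v < w := by
    have hw : ¬ (w : ℕ) < n := fun hw => hbip v w h (propext (iff_of_true hv hw))
    exact Fin.lt_def.2 (by omega)
  have hlt' (v w : Fin (n + n)) (h : G.Adj v w) (hv : ¬ (v : ℕ) < n) : w < v := by
    have hw : (w : ℕ) < n := by
      by_contra hw
      exact hbip v w h (propext (iff_of_false hv hw))
    exact Fin.lt_def.2 (by omega)
  obtain ⟨s, hst, hs, hs'⟩ := exists_biregular_subset (k := k) (d := Δ)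
    (fun v => G.neighborFinset v) (fun v => hreg v)
    (fun v => by
      rw [← hreg v, ← G.card_neighborFinset_eq_degree]
      congr 1
      ext u
      simp [G.adj_comm]) (by omega)
  have hadj (v w) (h : w ∈ s v) : G.Adj v w := by simpa using hst v h
  refine ⟨Finset.univ.filter fun p => (p.1 < p.2 ∧ G.Adj p.1 p.2) ∧ p.2 ∈ s p.1, ?_, ?_⟩
  · intro p
    simp only [Finset.mem_filter, Finset.mem_univ, true_and]
    exact fun h => h.1
  ext v
  simp only [Finsupp.add_apply, Finsupp.finsetSum_apply, Finsupp.single_apply, hm,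
    Finsupp.coe_equivFunOnFinite_symm, hk2, ← Finset.card_filter]
  by_cases hv : (v : ℕ) < n
  · rw [← add_zero k, ← hs v]
    congr 1
    · refine Finset.card_bij' (fun p _ => p.2) (fun w _ => (v, w)) ?_ ?_ ?_ ?_
      · rintro ⟨a, b⟩ h
        simp at h
        grind
      · intro w hw
        have := hadj v w hw
        simp [hw, this, hlt v w this hv]
      · rintro ⟨a, b⟩ h
        simp at h
        simp [h]
      · simp
    · rw [Finset.card_eq_zero, Finset.filter_eq_empty_iff]
      rintro ⟨a, b⟩ h rfl
      simp only [Finset.mem_sdiff, Finset.mem_filter, Finset.mem_univ, true_and] at h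
      exact (hE _ h.1).2 hv
  · rw [← zero_add k]
    congr 1
    · rw [Finset.card_eq_zero, Finset.filter_eq_empty_iff]
      rintro ⟨a, b⟩ h rfl
      simp only [Finset.mem_filter, Finset.mem_univ, true_and] at h
      exact hv (hE _ h.1).1
    · have hcard : (G.neighborFinset v \ Finset.univ.filter fun u => v ∈ s u).card = k := by
        rw [Finset.card_sdiff_of_subset, hs' v, G.card_neighborFinset_eq_degree, hreg v]
        · omega
        · intro u hu
          simpa using (hadj u v (by simpa using hu)).symm
      rw [← hcard]
      refine Finset.card_bij' (fun p _ => p.1) (fun w _ => (w, v)) ?_ ?_ ?_ ?_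
      · rintro ⟨a, b⟩ h
        simp only [Finset.mem_filter, Finset.mem_sdiff, Finset.mem_univ, true_and] at h
        obtain ⟨⟨h1, h2⟩, rfl⟩ := h
        simpa using ⟨h1.2.symm, fun h => h2 ⟨h1, h⟩⟩
      · intro w hw
        simp only [Finset.mem_sdiff, SimpleGraph.mem_neighborFinset, Finset.mem_filter,
          Finset.mem_univ, true_and] at hw
        have := hlt' v w hw.1 hv
        simp [this, hw.1.symm, hw.2]
      · rintro ⟨a, b⟩ h
        simp at h
        simp [h]
      · simp
end

section
/- Let n be an even positive integer and let G be a Δ-regular bipartite simple graph on 2n vertices with bipartition into the parts {1,…,n} and {n+1,…,2n}, where Δ is even and Δ ≥ 1. Then the Alon–Tarsi number of G equals Δ/2 + 1. -/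
open MvPolynomial

open Finset in
/-- A nonempty regular bipartite relation contains a perfect matching. -/
theorem exists_perm_of_regular {V : Type*} [Fintype V] [DecidableEq V] (r : V → V → Prop)
    [DecidableRel r] (d : ℕ) (hout : ∀ v, #{w | r v w} = d + 1) (hin : ∀ w, #{v | r v w} = d + 1) :
    ∃ f : Equiv.Perm V, ∀ v, r v (f v) := by
  have hall : ∀ A : Finset V, #A ≤ #({b | ∃ a ∈ A, r a b} : Finset V) := by
    intro A
    refine Nat.le_of_mul_le_mul_right (c := d + 1) ?_ d.succ_pos
    refine card_mul_le_card_mul r (fun a ha => ?_) fun b _ => ?_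
    · rw [← hout a]
      refine card_le_card fun b hb => ?_
      simp only [mem_filter, mem_univ, true_and, mem_bipartiteAbove] at hb ⊢
      exact ⟨⟨a, ha, hb⟩, hb⟩
    · rw [← hin b]
      exact card_le_card (filter_subset_filter _ (subset_univ _))
  obtain ⟨f, hf, hr⟩ := (Fintype.all_card_le_filter_rel_iff_exists_injective r).1 hall
  exact ⟨Equiv.ofBijective f (Finite.injective_iff_bijective.1 hf), hr⟩

open Finset in
/-- A regular bipartite relation of degree `d` contains a regular one of every degree `k ≤ d`. -/
theorem exists_regular_subrelation {V : Type*} [Fintype V] (r : V → V → Prop)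
    [DecidableRel r] {k d : ℕ} (hkd : k ≤ d)
    (hout : ∀ v, #{w | r v w} = d) (hin : ∀ w, #{v | r v w} = d) :
    ∃ (r' : V → V → Prop) (_ : DecidableRel r'), (∀ v w, r' v w → r v w) ∧
      (∀ v, #{w | r' v w} = k) ∧ ∀ w, #{v | r' v w} = k := by
  classical
  induction hkd using Nat.decreasingInduction with
  | self => exact ⟨r, inferInstance, fun _ _ h => h, hout, hin⟩
  | of_succ k _ ih =>
    obtain ⟨r', _, hsub, ho, hi⟩ := ih
    obtain ⟨f, hf⟩ := exists_perm_of_regular r' k ho hi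
    refine ⟨fun v w => r' v w ∧ w ≠ f v, inferInstance, fun v w h => hsub v w h.1,
      fun v => ?_, fun w => ?_⟩
    · have h : ({w | r' v w ∧ w ≠ f v} : Finset V) = ({w | r' v w} : Finset V).erase (f v) := by
        ext w; simp [and_comm]
      rw [h, card_erase_of_mem (by simpa using hf v), ho, Nat.add_sub_cancel]
    · have h : ({v | r' v w ∧ w ≠ f v} : Finset V) =
          ({v | r' v w} : Finset V).erase (f.symm w) := by
        ext v; simp [and_comm, Equiv.eq_symm_apply, eq_comm]
      rw [h, card_erase_of_mem (by simpa using hf (f.symm w)), hi, Nat.add_sub_cancel]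

open Finset in
/-- For edges directed from `L` to its complement, every monomial arising from a choice of an
endpoint of each edge occurs in the graph polynomial: there is no cancellation. -/
theorem coeff_prod_X_sub_X_ne_zero_s7 {V : Type*} [DecidableEq V] (L : Set V)
    (s t : Finset (V × V)) (hs : ∀ p ∈ s, p.1 ∈ L ∧ p.2 ∉ L) (hts : t ⊆ s) :
    coeff (∑ p ∈ s \ t, Finsupp.single p.1 1 + ∑ p ∈ t, Finsupp.single p.2 1)
      (∏ p ∈ s, (X p.1 - X p.2 : MvPolynomial V ℤ)) ≠ 0 := by
  classical
  set e : Finset (V × V) → V →₀ ℕ := fun t =>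
    ∑ p ∈ s \ t, Finsupp.single p.1 1 + ∑ p ∈ t, Finsupp.single p.2 1 with he
  have hcard : ∀ u ⊆ s, Finsupp.weight (fun v => if v ∈ L then 0 else 1) (e u) = #u := by
    intro u hu
    simp only [he, map_add, map_sum, Finsupp.weight_single]
    rw [sum_eq_zero fun p hp => by simp [(hs p (mem_sdiff.1 hp).1).1],
      sum_congr rfl fun p hp => by rw [if_neg (hs p (hu hp)).2]]
    simp
  have hterm : ∀ u : Finset (V × V),
      ((-1) ^ #u * ∏ p ∈ s \ u, X p.1) * ∏ p ∈ u, X p.2 =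
        monomial (e u) ((-1 : ℤ) ^ #u) := by
    intro u
    have h1 : ∀ (g : V × V → V) (u : Finset (V × V)), ∏ p ∈ u, (X (g p) : MvPolynomial V ℤ) =
        monomial (∑ p ∈ u, Finsupp.single (g p) 1) 1 := by
      intro g u
      rw [monomial_sum_one]
      rfl
    rw [h1 Prod.fst, h1 Prod.snd, mul_assoc, monomial_mul, one_mul,
      show ((-1 : MvPolynomial V ℤ) ^ #u) = C ((-1 : ℤ) ^ #u) by simp, C_mul_monomial, mul_one]
  change coeff (e t) _ ≠ 0
  have hsum : coeff (e t) (∏ p ∈ s, (X p.1 - X p.2 : MvPolynomial V ℤ)) =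
      (-1) ^ #t * #{u ∈ s.powerset | e u = e t} := by
    rw [prod_sub, coeff_sum, card_filter, Nat.cast_sum, mul_sum]
    refine sum_congr rfl fun u hu => ?_
    rw [hterm, coeff_monomial]
    split_ifs with h
    · rw [← hcard u (mem_powerset.1 hu), h, hcard t hts]
      simp
    · simp
  rw [hsum]
  refine mul_ne_zero (pow_ne_zero _ (by norm_num)) (Nat.cast_ne_zero.2 (card_ne_zero_of_mem
    (a := t) ?_))
  simpa using hts

/-- for an even positive n and a Δ-regular bipartite simple graph G on 2n vertices
with parts {0,…,n-1} and {n,…,2n-1}, with Δ even and Δ ≥ 1, the Alon–Tarsi number of G equals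
Δ/2 + 1. -/
theorem statement_7 (n : ℕ) (hn : 0 < n) (hev : Even n) (Δ : ℕ) (hΔ : Even Δ) (hΔ1 : 1 ≤ Δ)
    (G : SimpleGraph (Fin (n + n))) [DecidableRel G.Adj]
    (hreg : G.IsRegularOfDegree Δ)
    (hbip : ∀ i j : Fin (n + n), G.Adj i j → (((i : ℕ) < n) ≠ ((j : ℕ) < n))) :
    ATNumber G inferInstance = Δ / 2 + 1 := by
  classical
  obtain ⟨k, rfl⟩ := hΔ
  have hdeg : ∀ v, (Finset.univ.filter fun w => G.Adj v w).card = k + k := fun v => by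
    rw [← hreg.degree_eq v, ← G.card_neighborFinset_eq_degree, G.neighborFinset_eq_filter]
  obtain ⟨r, _, hr, hout, hin⟩ := exists_regular_subrelation G.Adj (k.le_add_right k) hdeg
    fun w => by simpa only [G.adj_comm] using hdeg w
  set s : Finset (Fin (n + n) × Fin (n + n)) :=
    Finset.univ.filter fun p => p.1 < p.2 ∧ G.Adj p.1 p.2 with hs
  have hpoly : graphPoly G inferInstance = ∏ p ∈ s, (X p.1 - X p.2) := by
    unfold graphPoly
    refine Finset.prod_congr ?_ fun _ _ => rfl
    ext p
    simp only [hs, Finset.mem_filter, Finset.mem_univ, true_and]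
  have hmem : ∀ p, p ∈ s ↔ (p.1 : ℕ) < n ∧ G.Adj p.1 p.2 := by
    intro p
    simp only [hs, Finset.mem_filter, Finset.mem_univ, true_and, Fin.lt_def]
    refine and_congr_left fun h => ?_
    have := hbip _ _ h
    simp only [ne_eq, eq_iff_iff] at this
    omega
  have hright : ∀ p ∈ s, ¬ (p.2 : ℕ) < n := fun p hp => by
    have h := (hmem p).1 hp
    have := hbip _ _ h.2
    simp only [ne_eq, eq_iff_iff] at this
    omega
  have hfst : ∀ (q : Fin (n + n) → Fin (n + n) → Prop) [DecidableRel q] (v : Fin (n + n)),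
      (∀ v w, q v w → G.Adj v w) → (v : ℕ) < n →
      (Finset.univ.filter fun w => q v w).card =
        ((s.filter fun p => q p.1 p.2).filter fun p => p.1 = v).card := by
    intro q _ v hq hv
    refine Finset.card_bij' (fun w _ => (v, w)) (fun p _ => p.2) ?_ ?_ ?_ ?_
    · intro w hw
      simp only [Finset.mem_filter, Finset.mem_univ, true_and] at hw
      simp [hmem, hv, hw, hq _ _ hw]
    · rintro ⟨a, b⟩ hp
      simp only [Finset.mem_filter] at hp
      obtain ⟨⟨_, h⟩, rfl⟩ := hp
      simpa using h
    · intro w _; rfl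
    · rintro ⟨a, b⟩ hp
      simp only [Finset.mem_filter] at hp
      simp [hp.2]
  have hsnd : ∀ v : Fin (n + n), ¬ (v : ℕ) < n →
      ((s.filter fun p => r p.1 p.2).filter fun p => p.2 = v).card = k := by
    intro v hv
    rw [← hin v]
    refine Finset.card_bij' (fun p _ => p.1) (fun w _ => (w, v)) ?_ ?_ ?_ ?_
    · rintro ⟨a, b⟩ hp
      simp only [Finset.mem_filter] at hp
      obtain ⟨⟨_, h⟩, rfl⟩ := hp
      simpa using h
    · intro w hw
      simp only [Finset.mem_filter, Finset.mem_univ, true_and] at hw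
      have := hbip _ _ (hr _ _ hw)
      simp only [ne_eq, eq_iff_iff] at this
      simp only [Finset.mem_filter, hmem, hw, hr _ _ hw, and_true]
      omega
    · rintro ⟨a, b⟩ hp
      simp only [Finset.mem_filter] at hp
      simp [hp.2]
    · intro w _; rfl
  have hcard : s.card = n * (k + k) := by
    rw [Finset.card_eq_sum_card_fiberwise (f := Prod.fst)
      (t := Finset.univ.filter fun v : Fin (n + n) => (v : ℕ) < n)
      fun p hp => by simpa using ((hmem p).1 hp).1]
    rw [Finset.sum_congr rfl (g := fun _ => k + k)]
    · rw [Finset.sum_const, Fin.card_filter_val_lt]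
      simp
    · intro v hv
      rw [← hdeg v, hfst G.Adj v (fun _ _ h => h) (by simpa using hv)]
      congr 2
      ext p
      simp only [Finset.mem_filter, hmem]
      tauto
  have hlower : ∀ m ∈ (graphPoly G inferInstance).support, k ≤ maxExp m := by
    intro m hm
    rw [hpoly, mem_support_iff] at hm
    have hhom := IsHomogeneous.prod s (fun p => (X p.1 - X p.2 : MvPolynomial (Fin (n + n)) ℤ))
      (fun _ => 1) fun p _ => (isHomogeneous_X _ _).sub (isHomogeneous_X _ _)
    have hw := hhom hm
    rw [Finsupp.weight_eq_sum, Finset.sum_const, hcard] at hw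
    have hle : ∑ i, m i ≤ (n + n) * maxExp m := by
      simpa using Finset.sum_le_card_nsmul Finset.univ m (maxExp m)
        fun i hi => Finset.le_sup (f := m) hi
    simp only [Pi.one_apply, smul_eq_mul, mul_one] at hw
    rw [hw] at hle
    nlinarith
  have hupper : ∃ m ∈ (graphPoly G inferInstance).support, maxExp m = k := by
    have hne := coeff_prod_X_sub_X_ne_zero_s7 {v : Fin (n + n) | (v : ℕ) < n} s
      (s.filter fun p => r p.1 p.2)
      (fun p hp => ⟨((hmem p).1 hp).1, hright p hp⟩) (Finset.filter_subset _ _)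
    refine ⟨_, by rw [hpoly, mem_support_iff]; exact hne, ?_⟩
    have : Nonempty (Fin (n + n)) := ⟨⟨0, by omega⟩⟩
    refine (Finset.sup_congr rfl fun v _ => ?_).trans (Finset.sup_const Finset.univ_nonempty k)
    simp only [Finsupp.coe_add, Finsupp.coe_finsetSum, Pi.add_apply, Finset.sum_apply,
      Finsupp.single_apply, ← Finset.card_filter]
    by_cases hv : (v : ℕ) < n
    · have h0 : ((s.filter fun p => r p.1 p.2).filter fun p => p.2 = v) = ∅ := by
        refine Finset.filter_eq_empty_iff.2 fun p hp h => ?_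
        exact hright p (Finset.mem_filter.1 hp).1 (h ▸ hv)
      have h1 := hfst r v hr hv
      have h2 := hfst G.Adj v (fun _ _ h => h) hv
      rw [Finset.filter_true_of_mem (s := s) fun p hp => ((hmem p).1 hp).2, hdeg] at h2
      have h3 := Finset.card_filter_add_card_filter_not (s := s.filter fun p => p.1 = v)
        (fun p => r p.1 p.2)
      rw [hout, Finset.filter_comm] at h1
      rw [h0, Finset.card_empty, add_zero, ← Finset.filter_not, Finset.filter_comm]
      omega
    · rw [hsnd v hv, Finset.filter_eq_empty_iff.2, Finset.card_empty, zero_add]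
      intro p hp h
      exact hv (h ▸ ((hmem p).1 (Finset.mem_sdiff.1 hp).1).1)
  have hinf : sInf {j : ℕ | ∃ m ∈ (graphPoly G inferInstance).support, maxExp m = j} = k := by
    refine le_antisymm (Nat.sInf_le hupper) (le_csInf ⟨k, hupper⟩ ?_)
    rintro _ ⟨m, hm, rfl⟩
    exact hlower m hm
  unfold ATNumber
  rw [hinf]
  omega
end
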